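/- arXiv:math/0211096 — 5 statements merged into one kernel-verified Lean document; each statement's English description precedes it below -/
import Mathlib

section
/- Let X be a rack. For each n ≥ 1 let C_n(X) be the free abelian group on n-tuples of elements of X (and C_n(X) = 0 for n ≤ 0), and define ∂_n : C_n(X) → C_{n−1}(X) on generators for n ≥ 2 by ∂_n(x₁,…,x_n) = Σ_{i=1}^{n} (−1)^i [ (x₁,…,x_{i−1},x_{i+1},…,x_n) − (x₁*x_i, …, x_{i−1}*x_i, x_{i+1},…,x_n) ], and ∂_n = 0 for n ≤ 1. Then ∂_{n−1} ∘ ∂_n = 0 for all n, so (C_*(X), ∂_*) is a chain complex. -/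
/-- The rack chain groups: `RC X n` is the free abelian group on `n`-tuples of
elements of `X` for `n ≥ 1`, and the trivial group for `n ≤ 0`. -/
def RC (X : Type) : ℕ → Type
  | 0 => PUnit
  | (n+1) => FreeAbelianGroup (Fin (n+1) → X)

instance RC.instAddCommGroup (X : Type) : ∀ n, AddCommGroup (RC X n)
  | 0 => inferInstanceAs (AddCommGroup PUnit)
  | (n+1) => inferInstanceAs (AddCommGroup (FreeAbelianGroup (Fin (n+1) → X)))

/-- The rack boundary map `∂_{n+1} : C_{n+1} → C_n`, given on a generator
`(x₁, …, x_{n+1})` (written as a function `Fin (n+1) → X`, with `i` 0-indexed, so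
the sign of the `i`-th summand is `(−1)^{i+1}`) by
`∑_i (−1)^{i+1} [(x₁,…,x̂ᵢ,…,x_{n+1}) − (x₁*xᵢ,…,x_{i−1}*xᵢ,x_{i+1},…,x_{n+1})]`;
the map `∂_1 : C_1 → C_0 = 0` is the zero map. -/
def rackD {X : Type} (op : X → X → X) : ∀ n, RC X (n + 1) →+ RC X n
  | 0 => 0
  | (n+1) =>
    (FreeAbelianGroup.lift fun x : Fin (n + 2) → X =>
      (∑ i : Fin (n + 2), ((-1 : ℤ) ^ ((i : ℕ) + 1)) •
        (FreeAbelianGroup.of (fun j => x (i.succAbove j)) -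
          FreeAbelianGroup.of (fun j =>
            if i.succAbove j < i then op (x (i.succAbove j)) (x i)
            else x (i.succAbove j)) : FreeAbelianGroup (Fin (n + 1) → X))) :
      FreeAbelianGroup (Fin (n + 2) → X) →+ FreeAbelianGroup (Fin (n + 1) → X))

/-- A face map with a general operation `g`. -/
def rackFace {X : Type} (g : X → X → X) {n : ℕ} (i : Fin (n + 1)) (x : Fin (n + 1) → X) :
    Fin n → X :=
  fun j => if i.succAbove j < i then g (x (i.succAbove j)) (x i) else x (i.succAbove j)

theorem rackFace_comm {X : Type} (g h : X → X → X)
    (H : ∀ a b c, g (h a c) (h b c) = h (g a b) c) {n : ℕ} (i j : Fin (n + 2)) (hij : i ≤ j)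
    (x : Fin (n + 3) → X) :
    rackFace g i (rackFace h j.succ x) = rackFace h j (rackFace g i.castSucc x) := by
  have e1 : j.succ.succAbove i = i.castSucc := Fin.succAbove_of_castSucc_lt _ _ (by
    simp only [Fin.lt_def, Fin.le_def, Fin.val_succ, Fin.val_castSucc] at *; omega)
  have e2 : i.castSucc.succAbove j = j.succ := Fin.succAbove_of_le_castSucc _ _ (by
    simpa using hij)
  funext k
  have e3 : j.succ.succAbove (i.succAbove k) = i.castSucc.succAbove (j.succAbove k) := by
    simp only [Fin.succAbove, Fin.lt_def, Fin.le_def, Fin.ext_iff] at *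
    split_ifs <;> simp_all <;> omega
  have c1 : i.castSucc < j.succ := by
    simp only [Fin.lt_def, Fin.le_def, Fin.val_succ, Fin.val_castSucc] at *; omega
  have c2 : ¬ j.succ < i.castSucc := not_lt.mpr c1.le
  have c3 : i.castSucc.succAbove (j.succAbove k) < j.succ ↔ j.succAbove k < j := by
    simp only [Fin.succAbove, Fin.lt_def, Fin.le_def] at *
    split_ifs <;> simp_all <;> omega
  have c4 : i.castSucc.succAbove (j.succAbove k) < i.castSucc ↔ i.succAbove k < i := by
    simp only [Fin.succAbove, Fin.lt_def, Fin.le_def] at *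
    split_ifs <;> simp_all <;> omega
  have c5 : i.succAbove k < i → j.succAbove k < j := by
    simp only [Fin.succAbove, Fin.lt_def, Fin.le_def] at *
    split_ifs <;> simp_all <;> omega
  simp only [rackFace, e1, e2, e3, c1, c2, c3, c4, if_true, if_false]
  by_cases a : i.succAbove k < i
  · simp [a, c5 a, H]
  · simp [a]

/-- The difference of the two faces, extended linearly. -/
def rackDF {X : Type} (op : X → X → X) {n : ℕ} (i : Fin (n + 1)) :
    FreeAbelianGroup (Fin (n + 1) → X) →+ FreeAbelianGroup (Fin n → X) :=
  FreeAbelianGroup.lift fun x =>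
    FreeAbelianGroup.of (rackFace (fun a _ => a) i x) - FreeAbelianGroup.of (rackFace op i x)

theorem rackDF_comm {X : Type} (op : X → X → X)
    (hR2 : ∀ a b c : X, op (op a b) c = op (op a c) (op b c))
    {n : ℕ} (i j : Fin (n + 2)) (hij : i ≤ j) (z : FreeAbelianGroup (Fin (n + 3) → X)) :
    rackDF op i (rackDF op j.succ z) = rackDF op j (rackDF op i.castSucc z) := by
  suffices h : (rackDF op i).comp (rackDF op j.succ) =
      (rackDF op j).comp (rackDF op i.castSucc) from DFunLike.congr_fun h z
  ext x
  simp only [AddMonoidHom.comp_apply, rackDF, FreeAbelianGroup.lift_apply_of, map_sub]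
  rw [rackFace_comm (fun a _ => a) (fun a _ => a) (by simp) i j hij,
    rackFace_comm (fun a _ => a) op (by simp) i j hij,
    rackFace_comm op (fun a _ => a) (by simp) i j hij,
    rackFace_comm op op (fun a b c => (hR2 a b c).symm) i j hij]
  abel

/-- The boundary as an alternating sum of face differences. -/
theorem rackD_eq {X : Type} (op : X → X → X) (n : ℕ) (z : FreeAbelianGroup (Fin (n + 2) → X)) :
    (rackD op (n + 1) z : FreeAbelianGroup (Fin (n + 1) → X)) =
      ∑ i : Fin (n + 2), ((-1 : ℤ) ^ ((i : ℕ) + 1)) • rackDF op i z := by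
  have h : (FreeAbelianGroup.lift fun x : Fin (n + 2) → X =>
      (∑ i : Fin (n + 2), ((-1 : ℤ) ^ ((i : ℕ) + 1)) •
        (FreeAbelianGroup.of (fun j => x (i.succAbove j)) -
          FreeAbelianGroup.of (fun j =>
            if i.succAbove j < i then op (x (i.succAbove j)) (x i)
            else x (i.succAbove j)) : FreeAbelianGroup (Fin (n + 1) → X))) :
      FreeAbelianGroup (Fin (n + 2) → X) →+ FreeAbelianGroup (Fin (n + 1) → X)) =
      ∑ i : Fin (n + 2), ((-1 : ℤ) ^ ((i : ℕ) + 1)) • rackDF op i := by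
    apply FreeAbelianGroup.lift_ext
    intro x
    rw [FreeAbelianGroup.lift_apply_of, AddMonoidHom.finsetSum_apply]
    refine Finset.sum_congr rfl fun i _ => ?_
    rw [AddMonoidHom.zsmul_apply, rackDF, FreeAbelianGroup.lift_apply_of]
    have e : rackFace (fun a _ => a) i x = fun j => x (i.succAbove j) := by
      funext j
      simp [rackFace]
    rw [e]
    rfl
  refine (DFunLike.congr_fun h z).trans ?_
  rw [AddMonoidHom.finsetSum_apply]
  rfl

theorem rack_cancel {A : Type} [AddCommGroup A] {n : ℕ} (T : Fin (n + 3) → Fin (n + 2) → A)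
    (hT : ∀ i j : Fin (n + 2), i ≤ j → T j.succ i = T i.castSucc j) :
    ∑ i : Fin (n + 3), ∑ j : Fin (n + 2),
      ((-1 : ℤ) ^ ((i : ℕ) + 1)) • ((-1 : ℤ) ^ ((j : ℕ) + 1)) • T i j = 0 := by
  have key : ∀ f : Fin (n + 3) → Fin (n + 2) → A,
      ∑ i, ∑ j, f i j = ∑ i : Fin (n + 2), ∑ j : Fin (n + 2),
        if i ≤ j then f i.castSucc j + f j.succ i else 0 := by
    intro f
    have h1 : ∀ j : Fin (n + 2), ∑ i : Fin (n + 3), f i j =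
        (∑ i : Fin (n + 2), if i ≤ j then f i.castSucc j else 0) +
        ∑ i : Fin (n + 2), if j ≤ i then f i.succ j else 0 := by
      intro j
      have a1 : ∑ i : Fin (n + 3), f i j =
          (∑ i : Fin (n + 3), if i ≤ j.castSucc then f i j else 0) +
          ∑ i : Fin (n + 3), if j.castSucc < i then f i j else 0 := by
        rw [← Finset.sum_add_distrib]
        refine Finset.sum_congr rfl fun i _ => ?_
        by_cases h : i ≤ j.castSucc
        · simp [h, not_lt.mpr h]
        · simp [h, not_le.mp h]
      rw [a1, Fin.sum_univ_castSucc, Fin.sum_univ_succ (n := n + 2)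
        (f := fun i => if j.castSucc < i then f i j else 0)]
      have b1 : ¬ Fin.last (n + 2) ≤ j.castSucc := not_le.mpr (Fin.castSucc_lt_last j)
      simp [b1, Fin.castSucc_lt_succ_iff]
    rw [Finset.sum_comm]
    simp only [h1, Finset.sum_add_distrib]
    rw [Finset.sum_comm, ← Finset.sum_add_distrib]
    refine Finset.sum_congr rfl fun i _ => ?_
    rw [← Finset.sum_add_distrib]
    refine Finset.sum_congr rfl fun j _ => ?_
    split_ifs <;> simp
  rw [key]
  refine Finset.sum_eq_zero fun i _ => Finset.sum_eq_zero fun j _ => ?_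
  split_ifs with h
  · rw [hT i j h, smul_smul, smul_smul, ← add_smul]
    simp only [Fin.val_succ, Fin.val_castSucc]
    ring_nf
    simp
  · rfl

/-- For a rack `X`, the composite of consecutive rack boundary maps
vanishes, `∂_n ∘ ∂_{n+1} = 0`, so `(C_*(X), ∂_*)` is a chain complex. -/
theorem stmt8 {X : Type} (op : X → X → X)
    (hR1 : ∀ a b : X, ∃! c : X, a = op c b)
    (hR2 : ∀ a b c : X, op (op a b) c = op (op a c) (op b c)) :
    ∀ n, (rackD op n).comp (rackD op (n+1)) = 0 := by
  intro n
  cases n with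
  | zero => ext1 z; rfl
  | succ n =>
    ext1 z
    change FreeAbelianGroup (Fin (n + 3) → X) at z
    change (rackD op (n + 1) (rackD op (n + 2) z) : FreeAbelianGroup (Fin (n + 1) → X)) = 0
    refine (rackD_eq op n _).trans ?_
    have e := rackD_eq op (n + 1) z
    refine (Finset.sum_congr rfl fun (i : Fin (n + 2)) _ => congrArg
      (fun w : FreeAbelianGroup (Fin (n + 2) → X) => ((-1 : ℤ) ^ ((i : ℕ) + 1)) • rackDF op i w) e).trans ?_
    simp only [map_sum, map_zsmul, Finset.smul_sum]
    rw [Finset.sum_comm]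
    refine Eq.trans ?_ (rack_cancel (fun i j => rackDF op j (rackDF op i z))
      (fun i j hij => rackDF_comm op hR2 i j hij z))
    refine Finset.sum_congr rfl fun i _ => Finset.sum_congr rfl fun j _ => ?_
    exact smul_comm _ _ _
end

section
/- Let X be a quandle. For n ≥ 2 let C_n^D(X) be the subgroup of the rack chain group C_n^R(X) generated by those n-tuples (x₁,…,x_n) with x_i = x_{i+1} for some i (and C_n^D(X) = 0 for n ≤ 1). Then the rack boundary map satisfies ∂_n(C_n^D(X)) ⊆ C_{n−1}^D(X), so the degenerate chains form a subcomplex of the rack chain complex. -/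
/-- A tuple is degenerate if two consecutive entries are equal. -/
def IsDeg {X : Type} {n : ℕ} (x : Fin n → X) : Prop :=
  ∃ i j : Fin n, (i : ℕ) + 1 = (j : ℕ) ∧ x i = x j

/-- `DSub X n ⊆ C_n^R(X)`: the subgroup generated by degenerate `n`-tuples
(zero for `n ≤ 1`, since a 1-tuple has no consecutive pair). -/
def DSub (X : Type) : ∀ n, AddSubgroup (RC X n)
  | 0 => ⊥
  | (n+1) =>
    (AddSubgroup.closure
      (FreeAbelianGroup.of '' {x : Fin (n+1) → X | IsDeg x}) :
      AddSubgroup (FreeAbelianGroup (Fin (n+1) → X)))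

theorem succAbove_val_aux {n : ℕ} (i : Fin (n + 1)) (j : Fin n) :
    ((i.succAbove j : Fin (n + 1)) : ℕ) = if (j : ℕ) < i then (j : ℕ) else j + 1 := by
  unfold Fin.succAbove
  simp only [Fin.lt_def, Fin.val_castSucc]
  split_ifs <;> simp

/-- Faces away from the repeated pair keep an adjacent pair of indices. -/
theorem exists_adj_aux {n : ℕ} (a b i : Fin (n + 1)) (hab : (a : ℕ) + 1 = b)
    (ha : i ≠ a) (hb : i ≠ b) :
    ∃ a' b' : Fin n, (a' : ℕ) + 1 = b' ∧ i.succAbove a' = a ∧ i.succAbove b' = b := by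
  obtain ⟨a', rfl⟩ := Fin.exists_succAbove_eq ha.symm
  obtain ⟨b', rfl⟩ := Fin.exists_succAbove_eq hb.symm
  refine ⟨a', b', ?_, rfl, rfl⟩
  rw [succAbove_val_aux, succAbove_val_aux] at hab
  split_ifs at hab <;> omega

theorem face_eq_aux {X : Type} {n : ℕ} (x : Fin (n + 1) → X) (a b : Fin (n + 1))
    (hab : (a : ℕ) + 1 = b) (h : x a = x b) (j : Fin n) :
    x (a.succAbove j) = x (b.succAbove j) := by
  by_cases hj : (j : ℕ) = a
  · have h1 : a.succAbove j = b := by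
      ext; rw [succAbove_val_aux]; split_ifs <;> omega
    have h2 : b.succAbove j = a := by
      ext; rw [succAbove_val_aux]; split_ifs <;> omega
    rw [h1, h2, h]
  · congr 1
    ext; rw [succAbove_val_aux, succAbove_val_aux]; split_ifs <;> omega

theorem face_op_eq_aux {X : Type} (op : X → X → X) (hQ1 : ∀ a : X, op a a = a)
    {n : ℕ} (x : Fin (n + 1) → X) (a b : Fin (n + 1))
    (hab : (a : ℕ) + 1 = b) (h : x a = x b) (j : Fin n) :
    (if a.succAbove j < a then op (x (a.succAbove j)) (x a) else x (a.succAbove j)) =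
    (if b.succAbove j < b then op (x (b.succAbove j)) (x b) else x (b.succAbove j)) := by
  rw [face_eq_aux x a b hab h j, h]
  by_cases hj : (j : ℕ) = a
  · have h2 : b.succAbove j = a := by
      ext; rw [succAbove_val_aux]; split_ifs <;> omega
    rw [h2, h, hQ1]; simp
  · have : (a.succAbove j < a) ↔ (b.succAbove j < b) := by
      rw [Fin.lt_def, Fin.lt_def, succAbove_val_aux, succAbove_val_aux]
      split_ifs <;> omega
    simp only [this]

/-- For a quandle `X`, the rack boundary maps the degenerate chains
into the degenerate chains: `∂_{n+1}(C_{n+1}^D(X)) ⊆ C_n^D(X)`, so the degenerate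
chains form a subcomplex of the rack chain complex. -/
theorem stmt9 {X : Type} (op : X → X → X)
    (hQ1 : ∀ a : X, op a a = a)
    (hQ2 : ∀ a b : X, ∃! c : X, a = op c b)
    (hQ3 : ∀ a b c : X, op (op a b) c = op (op a c) (op b c)) :
    ∀ n, ∀ c ∈ DSub X (n + 1), rackD op n c ∈ DSub X n := by
  intro n
  cases n with
  | zero => intro c _; exact AddSubgroup.zero_mem _
  | succ n =>
    intro c hc
    have key : (AddSubgroup.closure
        (FreeAbelianGroup.of '' {x : Fin (n+2) → X | IsDeg x}) :
        AddSubgroup (FreeAbelianGroup (Fin (n+2) → X))) ≤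
        (AddSubgroup.closure
        (FreeAbelianGroup.of '' {x : Fin (n+1) → X | IsDeg x}) :
        AddSubgroup (FreeAbelianGroup (Fin (n+1) → X))).comap
        (FreeAbelianGroup.lift fun x : Fin (n + 2) → X =>
      (∑ i : Fin (n + 2), ((-1 : ℤ) ^ ((i : ℕ) + 1)) •
        (FreeAbelianGroup.of (fun j => x (i.succAbove j)) -
          FreeAbelianGroup.of (fun j =>
            if i.succAbove j < i then op (x (i.succAbove j)) (x i)
            else x (i.succAbove j)) : FreeAbelianGroup (Fin (n + 1) → X)))) := by
      rw [AddSubgroup.closure_le]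
      rintro _ ⟨x, ⟨a, b, hab, h⟩, rfl⟩
      rw [SetLike.mem_coe, AddSubgroup.mem_comap, FreeAbelianGroup.lift_apply_of]
      have hne : b ≠ a := by rintro rfl; omega
      rw [← Finset.add_sum_erase _ _ (Finset.mem_univ a),
        ← Finset.add_sum_erase _ _ (Finset.mem_erase.2 ⟨hne, Finset.mem_univ b⟩),
        ← add_assoc]
      refine AddSubgroup.add_mem _ ?_ (AddSubgroup.sum_mem _ ?_)
      · rw [funext (face_op_eq_aux op hQ1 x a b hab h), funext (face_eq_aux x a b hab h), ← hab]
        rw [← add_smul, pow_succ _ ((a : ℕ) + 1)]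
        simp
      · intro i hi
        simp only [Finset.mem_erase, Finset.mem_univ, and_true] at hi
        obtain ⟨a', b', hab', rfl, rfl⟩ := exists_adj_aux a b i hab hi.2 hi.1
        refine AddSubgroup.zsmul_mem _ (AddSubgroup.sub_mem _ ?_ ?_) _
        · exact AddSubgroup.subset_closure ⟨_, ⟨a', b', hab', h⟩, rfl⟩
        · refine AddSubgroup.subset_closure ⟨_, ⟨a', b', hab', ?_⟩, rfl⟩
          have hlt : (i.succAbove a' < i) ↔ (i.succAbove b' < i) := by
            have h1 := hi.1
            have h2 := hi.2
            rw [Ne, Fin.ext_iff] at h1 h2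
            rw [Fin.lt_def, Fin.lt_def]
            omega
          simp only [hlt, h]
    exact key hc
end

section
/- Let X be a quandle. The short exact sequence of chain complexes 0 → C_*^D(X) → C_*^R(X) → C_*^Q(X) → 0 splits in the strong sense: there is a chain map s : C_*^Q(X) → C_*^R(X) (commuting with the boundary maps) such that the composition of s with the quotient chain map C_*^R(X) → C_*^Q(X) is the identity. Consequently, for every n and every abelian group G, H_n^R(X; G) ≅ H_n^D(X; G) ⊕ H_n^Q(X; G). -/
/-- Homology with coefficients in `G` of a (nonnegatively graded) chain complex of
abelian groups given by a family of boundary maps `d n : A (n+1) →+ A n`: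
`coefH d G n = ker(d_n ⊗ id_G) / im(d_{n+1} ⊗ id_G)` (computed in `A (n+1) ⊗ G`). -/
noncomputable def coefH (A : ℕ → Type) [∀ n, AddCommGroup (A n)]
    (d : ∀ n, A (n + 1) →+ A n) (G : Type) [AddCommGroup G] (n : ℕ) : Type :=
  ↥(LinearMap.ker
      (TensorProduct.map (d n).toIntLinearMap (LinearMap.id : G →ₗ[ℤ] G))) ⧸
    ((LinearMap.range
        (TensorProduct.map (d (n+1)).toIntLinearMap (LinearMap.id : G →ₗ[ℤ] G))).comap
      (LinearMap.ker
        (TensorProduct.map (d n).toIntLinearMap (LinearMap.id : G →ₗ[ℤ] G))).subtype)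

noncomputable instance coefH.instAddCommGroup (A : ℕ → Type) [∀ n, AddCommGroup (A n)]
    (d : ∀ n, A (n + 1) →+ A n) (G : Type) [AddCommGroup G] (n : ℕ) :
    AddCommGroup (coefH A d G n) :=
  inferInstanceAs (AddCommGroup
    (↥(LinearMap.ker
        (TensorProduct.map (d n).toIntLinearMap (LinearMap.id : G →ₗ[ℤ] G))) ⧸
      ((LinearMap.range
          (TensorProduct.map (d (n+1)).toIntLinearMap (LinearMap.id : G →ₗ[ℤ] G))).comap
        (LinearMap.ker
          (TensorProduct.map (d n).toIntLinearMap (LinearMap.id : G →ₗ[ℤ] G))).subtype)))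


namespace QSplit

/-- free abelian group on `n`-tuples, for every `n` including `0` -/
abbrev C (X : Type) (n : ℕ) : Type := FreeAbelianGroup (Fin n → X)

variable {X : Type}

/-- append an entry on the right -/
noncomputable def app (n : ℕ) (x : X) : C X n →+ C X (n+1) :=
  FreeAbelianGroup.lift fun w => FreeAbelianGroup.of (Fin.snoc w x : Fin (n+1) → X)

theorem app_of (n : ℕ) (x : X) (w : Fin n → X) :
    app n x (FreeAbelianGroup.of w) = FreeAbelianGroup.of (Fin.snoc w x : Fin (n+1) → X) :=
  FreeAbelianGroup.lift_apply_of _ _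

/-- right translation of all the entries -/
noncomputable def act (op : X → X → X) (n : ℕ) (y : X) : C X n →+ C X n :=
  FreeAbelianGroup.lift fun w => FreeAbelianGroup.of (fun j => op (w j) y)

theorem act_of (op : X → X → X) (n : ℕ) (x : X) (w : Fin n → X) :
    act op n x (FreeAbelianGroup.of w) = FreeAbelianGroup.of (fun j => op (w j) x) :=
  FreeAbelianGroup.lift_apply_of _ _

theorem act_zero (op : X → X → X) (x : X) (c : C X 0) : act op 0 x c = c := by
  induction c using FreeAbelianGroup.induction_on with
  | zero => simp
  | of w =>
    rw [act_of]
    congr 1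
    funext j
    exact j.elim0
  | neg w h => simp only [map_neg, h]
  | add a b ha hb => simp only [map_add, ha, hb]

theorem act_app (op : X → X → X) (n : ℕ) (x y : X) (c : C X n) :
    act op (n+1) y (app n x c) = app n (op x y) (act op n y c) := by
  induction c using FreeAbelianGroup.induction_on with
  | zero => simp
  | of w =>
    rw [app_of, act_of, act_of, app_of]
    congr 1
    funext j
    refine Fin.lastCases ?_ (fun k => ?_) j <;> simp
  | neg w h => simp only [map_neg, h]
  | add a b ha hb => simp only [map_add, ha, hb]

/-- one half of the boundary -/
noncomputable def dd (op : X → X → X) (n : ℕ) : C X (n+1) →+ C X n :=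
  FreeAbelianGroup.lift fun x =>
    ∑ i : Fin (n + 1), ((-1 : ℤ) ^ ((i : ℕ) + 1)) •
      FreeAbelianGroup.of (fun j =>
            if i.succAbove j < i then op (x (i.succAbove j)) (x i)
            else x (i.succAbove j))

theorem dd_of (op : X → X → X) (n : ℕ) (x : Fin (n+1) → X) :
    dd op n (FreeAbelianGroup.of x) = ∑ i : Fin (n + 1), ((-1 : ℤ) ^ ((i : ℕ) + 1)) •
      FreeAbelianGroup.of (fun j =>
            if i.succAbove j < i then op (x (i.succAbove j)) (x i)
            else x (i.succAbove j)) :=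
  FreeAbelianGroup.lift_apply_of _ _

theorem dd_app_zero (op : X → X → X) (x : X) (c : C X 0) :
    dd op 0 (app 0 x c) = - c := by
  induction c using FreeAbelianGroup.induction_on with
  | zero => simp
  | of w =>
    rw [app_of, dd_of]
    simp
    congr 1
    funext j
    exact j.elim0
  | neg w h => simp only [map_neg, h]
  | add a b ha hb => simp only [map_add, ha, hb]; abel

theorem dd_app (op : X → X → X) (n : ℕ) (x : X) (c : C X (n+1)) :
    dd op (n+1) (app (n+1) x c) = app n x (dd op n c) +
      ((-1 : ℤ) ^ (n+2)) • act op (n+1) x c := by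
  induction c using FreeAbelianGroup.induction_on with
  | zero => simp
  | of w =>
    rw [app_of, dd_of, dd_of, act_of, Fin.sum_univ_castSucc, map_sum]
    congr 1
    · refine Finset.sum_congr rfl fun i _ => ?_
      rw [map_zsmul, app_of]
      congr 2
      funext j
      refine Fin.lastCases ?_ (fun k => ?_) j
      · have : (i.castSucc).succAbove (Fin.last n) = Fin.last (n+1) := by
          rw [Fin.succAbove_castSucc_of_le _ _ (Fin.le_last i)]; simp
        rw [this]
        have h2 : ¬ (Fin.last (n+1) < i.castSucc) := not_lt.mpr (Fin.le_last _)
        simp [h2]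
      · have : (i.castSucc).succAbove (Fin.castSucc k) = (i.succAbove k).castSucc := by
          simp
        rw [this]
        simp only [Fin.snoc_castSucc, Fin.castSucc_lt_castSucc_iff]
    · simp [Fin.castSucc_lt_last]
  | neg w h => simp only [map_neg, h, smul_neg]; abel
  | add a b ha hb => simp only [map_add, ha, hb, smul_add]; abel

/-- the splitting -/
noncomputable def S (X : Type) : ∀ n, C X n →+ C X n
  | 0 => AddMonoidHom.id _
  | 1 => AddMonoidHom.id _
  | (n+2) => FreeAbelianGroup.lift fun w =>
      app (n+1) (w (Fin.last (n+1))) (S X (n+1) (FreeAbelianGroup.of (Fin.init w))) -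
      app (n+1) (w (Fin.last n).castSucc) (S X (n+1) (FreeAbelianGroup.of (Fin.init w)))

theorem S_app_app (n : ℕ) (x y : X) (c : C X n) :
    S X (n+2) (app (n+1) x (app n y c)) =
      app (n+1) x (S X (n+1) (app n y c)) - app (n+1) y (S X (n+1) (app n y c)) := by
  induction c using FreeAbelianGroup.induction_on with
  | zero => simp
  | of w =>
    rw [app_of, app_of, S, FreeAbelianGroup.lift_apply_of]
    simp
  | neg w h => simp only [map_neg, h]; abel
  | add a b ha hb => simp only [map_add, ha, hb]; abel

theorem of_snoc {n : ℕ} (w : Fin (n+1) → X) :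
    FreeAbelianGroup.of w = app n (w (Fin.last n)) (FreeAbelianGroup.of (Fin.init w)) := by
  rw [app_of, Fin.snoc_init_self]

theorem S_key (n : ℕ) (x y : X) (c : C X n) :
    S X (n+1) (app n x c) - app n x (S X n c) = S X (n+1) (app n y c) - app n y (S X n c) := by
  induction c using FreeAbelianGroup.induction_on with
  | zero => simp
  | of w =>
    cases n with
    | zero => simp [S]
    | succ n => rw [of_snoc w, S_app_app, S_app_app]; abel
  | neg w h =>
    simp only [map_neg]
    rw [← neg_inj] at h
    convert h using 1 <;> abel
  | add a b ha hb =>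
    simp only [map_add]
    convert congrArg₂ (· + ·) ha hb using 1 <;> abel

theorem S_act (op : X → X → X) (n : ℕ) (y : X) (c : C X n) :
    S X n (act op n y c) = act op n y (S X n c) := by
  induction c using FreeAbelianGroup.induction_on with
  | zero => simp
  | of w =>
    induction n with
    | zero => simp [S]
    | succ n ih =>
      cases n with
      | zero => simp [S]
      | succ n =>
        have h := ih (Fin.init w)
        rw [of_snoc w, of_snoc (Fin.init w)] at *
        rw [act_app, act_app, S_app_app, S_app_app, map_sub, act_app, act_app]
        rw [← act_app, h]
  | neg w h => simp only [map_neg, h]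
  | add a b ha hb => simp only [map_add, ha, hb]

theorem S_dd (op : X → X → X) (h1 : ∀ a, op a a = a) (n : ℕ) (c : C X (n+1)) :
    dd op n (S X (n+1) c) = S X n (dd op n c) := by
  induction c using FreeAbelianGroup.induction_on with
  | zero => simp
  | of w =>
    induction n with
    | zero => simp [S]
    | succ n ih =>
      have h := ih (Fin.init w)
      rw [of_snoc w, of_snoc (Fin.init w)]
      rw [of_snoc (Fin.init w)] at h
      generalize w (Fin.last (n+1)) = x at *
      generalize Fin.init w (Fin.last n) = y at *
      generalize (FreeAbelianGroup.of (Fin.init (Fin.init w))) = c at *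
      rw [S_app_app, map_sub, dd_app, dd_app, h, dd_app, map_add, map_zsmul, S_act]
      have e : S X (n+1) (app n x (dd op n (app n y c))) =
          app n x (S X n (dd op n (app n y c))) - app n y (S X n (dd op n (app n y c)))
          - ((-1 : ℤ)^(n+2)) • act op (n+1) y (S X (n+1) (app n y c)) := by
        rw [← S_act, act_app, h1]
        cases n with
        | zero => simp [dd_app_zero, S, act_zero]
        | succ n =>
          rw [dd_app]
          have k := S_key (n+1) x y (act op (n+1) y c)
          simp only [map_add, map_zsmul, S_app_app, map_sub]
          rw [sub_eq_iff_eq_add] at k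
          have hp : (-1 : ℤ)^(n+1+2) = - (-1 : ℤ)^(n+2) := by rw [pow_succ (-1 : ℤ) (n+2)]; ring
          rw [k, hp]
          generalize (-1 : ℤ)^(n+2) = e
          simp only [smul_add, smul_sub, mul_neg, mul_one, neg_smul]
          abel
      rw [e]
      abel
  | neg w h => simp only [map_neg, h]
  | add a b ha hb => simp only [map_add, ha, hb]

/-- degenerate part -/
def DD (X : Type) (n : ℕ) : AddSubgroup (C X n) :=
  AddSubgroup.closure (FreeAbelianGroup.of '' {x : Fin n → X | IsDeg x})

theorem S_deg (n : ℕ) (w : Fin n → X) (hw : IsDeg w) : S X n (FreeAbelianGroup.of w) = 0 := by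
  induction n with
  | zero => obtain ⟨i, _⟩ := hw; exact i.elim0
  | succ n ih =>
    obtain ⟨i, j, hij, hw⟩ := hw
    cases n with
    | zero => omega
    | succ n =>
      rw [of_snoc w, of_snoc (Fin.init w), S_app_app, ← of_snoc]
      by_cases hj : (j : ℕ) = n + 1
      · have h1 : j = Fin.last (n+1) := Fin.ext hj
        have h2 : i = (Fin.last n).castSucc := Fin.ext (by simp; omega)
        rw [h1, h2] at hw
        simp [Fin.init, hw]
      · rw [ih (Fin.init w) ⟨⟨i, by omega⟩, ⟨j, by omega⟩, hij, hw⟩]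
        simp

theorem S_DD (n : ℕ) (c : C X n) (hc : c ∈ DD X n) : S X n c = 0 := by
  have : DD X n ≤ (S X n).ker := by
    refine (AddSubgroup.closure_le _).mpr ?_
    rintro _ ⟨w, hw, rfl⟩
    exact S_deg n w hw
  exact this hc

theorem app_DD (n : ℕ) (x : X) (c : C X n) (hc : c ∈ DD X n) : app n x c ∈ DD X (n+1) := by
  have : DD X n ≤ (DD X (n+1)).comap (app n x) := by
    refine (AddSubgroup.closure_le _).mpr ?_
    rintro _ ⟨w, ⟨i, j, hij, hw⟩, rfl⟩
    refine AddSubgroup.subset_closure ⟨Fin.snoc w x, ⟨i.castSucc, j.castSucc, by simpa using hij, by simpa using hw⟩, (app_of n x w).symm⟩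
  exact this hc

theorem sub_S_mem (n : ℕ) (c : C X n) : c - S X n c ∈ DD X n := by
  induction c using FreeAbelianGroup.induction_on with
  | zero => simp
  | of w =>
    induction n with
    | zero => simp [S]
    | succ n ih =>
      cases n with
      | zero => simp [S]
      | succ n =>
        have h := ih (Fin.init w)
        have hd : app (n+1) (Fin.init w (Fin.last n)) (FreeAbelianGroup.of (Fin.init w)) ∈ DD X (n+2) := by
          rw [app_of]
          refine AddSubgroup.subset_closure ⟨_, ⟨(Fin.last n).castSucc, Fin.last (n+1), by simp, ?_⟩, rfl⟩
          rw [Fin.snoc_castSucc, Fin.snoc_last]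
        rw [of_snoc w]
        have e := S_app_app n (w (Fin.last (n+1))) (Fin.init w (Fin.last n)) (FreeAbelianGroup.of (Fin.init (Fin.init w)))
        rw [← of_snoc] at e
        rw [e]
        have a1 := app_DD _ (w (Fin.last (n+1))) _ h
        have a2 := app_DD _ (Fin.init w (Fin.last n)) _ h
        have := (DD X (n+2)).add_mem ((DD X (n+2)).sub_mem a1 a2) hd
        simp only [map_sub] at this
        convert this using 1
        abel
  | neg w h =>
    have := (DD X n).neg_mem h
    rw [map_neg]
    convert this using 1
    abel
  | add a b ha hb =>
    have := (DD X n).add_mem ha hb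
    rw [map_add]
    convert this using 1
    abel

/-- the splitting on the chain groups -/
noncomputable def sR (X : Type) : ∀ n, RC X n →+ RC X n
  | 0 => 0
  | (n+1) => S X (n+1)

theorem rackD_eq (op : X → X → X) (n : ℕ) (c : C X (n+2)) :
    rackD op (n+1) c = (dd (fun a _ => a) (n+1) c - dd op (n+1) c : C X (n+1)) := by
  induction c using FreeAbelianGroup.induction_on with
  | zero => simp; exact map_zero _
  | of w =>
    rw [dd_of, dd_of, ← Finset.sum_sub_distrib]
    refine (FreeAbelianGroup.lift_apply_of _ _).trans ?_
    refine Finset.sum_congr rfl fun i _ => ?_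
    simp only [ite_self]
    exact smul_sub _ _ _
  | neg w h =>
    refine (map_neg (rackD op (n+1)) _).trans ?_
    rw [h, map_neg, map_neg]
    change - (_ - _ : C X (n+1)) = _
    abel
  | add a b ha hb =>
    refine (map_add (rackD op (n+1)) _ _).trans ?_
    rw [ha, hb, map_add, map_add]
    change (_ - _ : C X (n+1)) + (_ - _ : C X (n+1)) = _
    abel

theorem sR_chain (op : X → X → X) (h1 : ∀ a, op a a = a) (n : ℕ) (c : RC X (n+1)) :
    rackD op n (sR X (n+1) c) = sR X n (rackD op n c) := by
  cases n with
  | zero => rfl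
  | succ n =>
    refine (rackD_eq op n (S X (n+2) c)).trans ?_
    refine Eq.trans ?_ (congrArg (S X (n+1)) (rackD_eq op n c)).symm
    rw [map_sub]
    exact congrArg₂ (· - ·) (S_dd _ (fun _ => rfl) (n+1) c) (S_dd op h1 (n+1) c)

theorem sR_D (n : ℕ) (c : RC X n) (hc : c ∈ DSub X n) : sR X n c = 0 := by
  cases n with
  | zero => rfl
  | succ n => exact S_DD (n+1) c hc

theorem sub_sR_mem (n : ℕ) (c : RC X n) : c - sR X n c ∈ DSub X n := by
  cases n with
  | zero => exact (rfl : (_ : PUnit) = _)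
  | succ n => exact sub_S_mem (n+1) c

theorem rackD_mem (op : X → X → X) (h1 : ∀ a, op a a = a) (n : ℕ) (c : RC X (n+1))
    (hc : c ∈ DSub X (n+1)) : rackD op n c ∈ DSub X n := by
  have h := sub_sR_mem n (rackD op n c)
  rwa [← sR_chain op h1, sR_D _ c hc, map_zero, sub_zero] at h

section homology

variable {A B D : ℕ → Type} [∀ n, AddCommGroup (A n)] [∀ n, AddCommGroup (B n)]
  [∀ n, AddCommGroup (D n)]

/-- tensoring a homomorphism with `G` -/
noncomputable abbrev tm {M N : Type} [AddCommGroup M] [AddCommGroup N] (f : M →+ N)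
    (G : Type) [AddCommGroup G] : TensorProduct ℤ M G →ₗ[ℤ] TensorProduct ℤ N G :=
  TensorProduct.map f.toIntLinearMap (LinearMap.id : G →ₗ[ℤ] G)

theorem tm_comp {M N P : Type} [AddCommGroup M] [AddCommGroup N] [AddCommGroup P]
    (g : N →+ P) (f : M →+ N) (G : Type) [AddCommGroup G] (z : TensorProduct ℤ M G) :
    tm g G (tm f G z) = tm (g.comp f) G z := by
  induction z with
  | zero => simp
  | tmul a b => rfl
  | add a b ha hb => simp only [map_add, ha, hb]

theorem tm_add {M N : Type} [AddCommGroup M] [AddCommGroup N]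
    (g f : M →+ N) (G : Type) [AddCommGroup G] (z : TensorProduct ℤ M G) :
    tm g G z + tm f G z = tm (g + f) G z := by
  induction z with
  | zero => simp
  | tmul a b => exact (TensorProduct.add_tmul (g a) (f a) b).symm
  | add a b ha hb => simp only [map_add, ← ha, ← hb]; abel

theorem tm_id {M : Type} [AddCommGroup M]
    (G : Type) [AddCommGroup G] (z : TensorProduct ℤ M G) :
    tm (AddMonoidHom.id M) G z = z := by
  induction z with
  | zero => simp
  | tmul a b => rfl
  | add a b ha hb => simp only [map_add, ha, hb]

theorem tm_zero {M N : Type} [AddCommGroup M] [AddCommGroup N]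
    (G : Type) [AddCommGroup G] (z : TensorProduct ℤ M G) :
    tm (0 : M →+ N) G z = 0 := by
  induction z with
  | zero => simp
  | tmul a b => exact TensorProduct.zero_tmul _ b
  | add a b ha hb => simp only [map_add, ha, hb, add_zero]

/-- the class of a cycle -/
noncomputable def cl (dA : ∀ n, A (n+1) →+ A n) (G : Type) [AddCommGroup G] (n : ℕ) :
    ↥(LinearMap.ker (tm (dA n) G)) →+ coefH A dA G n :=
  (Submodule.mkQ ((LinearMap.range (tm (dA (n+1)) G)).comap
      (LinearMap.ker (tm (dA n) G)).subtype)).toAddMonoidHom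

theorem cl_surj (dA : ∀ n, A (n+1) →+ A n) (G : Type) [AddCommGroup G] (n : ℕ) :
    Function.Surjective (cl dA G n) := Submodule.mkQ_surjective _

/-- induced map on cycles -/
noncomputable def zmap (dA : ∀ n, A (n+1) →+ A n) (dB : ∀ n, B (n+1) →+ B n)
    (f : ∀ n, A n →+ B n) (hf : ∀ n, (dB n).comp (f (n+1)) = (f n).comp (dA n))
    (G : Type) [AddCommGroup G] (n : ℕ) :
    ↥(LinearMap.ker (tm (dA n) G)) →ₗ[ℤ] ↥(LinearMap.ker (tm (dB n) G)) :=
  (tm (f (n+1)) G).restrict (by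
    intro z hz
    rw [LinearMap.mem_ker] at hz ⊢
    rw [tm_comp, hf, ← tm_comp, hz, map_zero])

/-- induced map on homology -/
noncomputable def hmap (dA : ∀ n, A (n+1) →+ A n) (dB : ∀ n, B (n+1) →+ B n)
    (f : ∀ n, A n →+ B n) (hf : ∀ n, (dB n).comp (f (n+1)) = (f n).comp (dA n))
    (G : Type) [AddCommGroup G] (n : ℕ) : coefH A dA G n →+ coefH B dB G n :=
  (Submodule.mapQ ((LinearMap.range (tm (dA (n+1)) G)).comap
      (LinearMap.ker (tm (dA n) G)).subtype)
      ((LinearMap.range (tm (dB (n+1)) G)).comap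
      (LinearMap.ker (tm (dB n) G)).subtype) (zmap dA dB f hf G n) (by
    rintro ⟨z, hz⟩ ⟨u, hu⟩
    refine ⟨tm (f (n+2)) G u, ?_⟩
    change _ = z at hu
    change _ = tm (f (n+1)) G z
    rw [← hu, tm_comp, tm_comp, hf])).toAddMonoidHom

theorem hmap_cl (dA : ∀ n, A (n+1) →+ A n) (dB : ∀ n, B (n+1) →+ B n)
    (f : ∀ n, A n →+ B n) (hf : ∀ n, (dB n).comp (f (n+1)) = (f n).comp (dA n))
    (G : Type) [AddCommGroup G] (n : ℕ) (z) :
    hmap dA dB f hf G n (cl dA G n z) = cl dB G n (zmap dA dB f hf G n z) := rfl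

theorem split_homology (dA : ∀ n, A (n+1) →+ A n) (dB : ∀ n, B (n+1) →+ B n)
    (dD : ∀ n, D (n+1) →+ D n)
    (i : ∀ n, D n →+ A n) (hi : ∀ n, (dA n).comp (i (n+1)) = (i n).comp (dD n))
    (p : ∀ n, A n →+ D n) (hp : ∀ n, (dD n).comp (p (n+1)) = (p n).comp (dA n))
    (q : ∀ n, A n →+ B n) (hq : ∀ n, (dB n).comp (q (n+1)) = (q n).comp (dA n))
    (s : ∀ n, B n →+ A n) (hs : ∀ n, (dA n).comp (s (n+1)) = (s n).comp (dB n))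
    (hpi : ∀ n, (p n).comp (i n) = AddMonoidHom.id _)
    (hqs : ∀ n, (q n).comp (s n) = AddMonoidHom.id _)
    (hps : ∀ n, (p n).comp (s n) = 0)
    (hqi : ∀ n, (q n).comp (i n) = 0)
    (hid : ∀ n, (i n).comp (p n) + (s n).comp (q n) = AddMonoidHom.id _)
    (G : Type) [AddCommGroup G] (n : ℕ) :
    Nonempty (coefH A dA G n ≃+ coefH D dD G n × coefH B dB G n) := by
  refine ⟨AddMonoidHom.toAddEquiv
    ((hmap dA dD p hp G n).prod (hmap dA dB q hq G n))
    ((hmap dD dA i hi G n).coprod (hmap dB dA s hs G n)) ?_ ?_⟩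
  · ext z
    obtain ⟨z, rfl⟩ := cl_surj dA G n z
    simp only [AddMonoidHom.comp_apply, AddMonoidHom.prod_apply, AddMonoidHom.coprod_apply,
      hmap_cl, ← map_add, AddMonoidHom.id_apply]
    congr 1
    ext
    change tm _ G (tm _ G z.1) + tm _ G (tm _ G z.1) = z.1
    rw [tm_comp, tm_comp, tm_add, hid, tm_id]
  · refine AddMonoidHom.ext ?_
    rintro ⟨u, v⟩
    obtain ⟨u, rfl⟩ := cl_surj dD G n u
    obtain ⟨v, rfl⟩ := cl_surj dB G n v
    simp only [AddMonoidHom.comp_apply, AddMonoidHom.prod_apply, AddMonoidHom.coprod_apply,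
      hmap_cl, ← map_add, AddMonoidHom.id_apply]
    refine Prod.ext ?_ ?_
    · dsimp only
      congr 1
      ext
      change tm _ G (tm _ G u.1 + tm _ G v.1) = u.1
      rw [map_add, tm_comp, tm_comp, hpi, hps, tm_id, tm_zero, add_zero]
    · dsimp only
      congr 1
      ext
      change tm _ G (tm _ G u.1 + tm _ G v.1) = v.1
      rw [map_add, tm_comp, tm_comp, hqi, hqs, tm_id, tm_zero, zero_add]

theorem generic (A : ℕ → Type) [∀ n, AddCommGroup (A n)] (d : ∀ n, A (n+1) →+ A n)
    (E : ∀ n, AddSubgroup (A n)) (σ : ∀ n, A n →+ A n)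
    (hmem : ∀ n (c : A (n+1)), c ∈ E (n+1) → d n c ∈ E n)
    (hchain : ∀ n (c : A (n+1)), d n (σ (n+1) c) = σ n (d n c))
    (hD : ∀ n (c : A n), c ∈ E n → σ n c = 0)
    (hsub : ∀ n (c : A n), c - σ n c ∈ E n) :
    ∃ dD : ∀ n, ↥(E (n+1)) →+ ↥(E n),
      (∀ n, ((E n).subtype).comp (dD n) = (d n).comp (E (n+1)).subtype) ∧
    ∃ dQ : ∀ n, (A (n+1) ⧸ E (n+1)) →+ (A n ⧸ E n),
      (∀ n, (dQ n).comp (QuotientAddGroup.mk' (E (n+1))) =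
        (QuotientAddGroup.mk' (E n)).comp (d n)) ∧
    ∃ s : ∀ n, (A n ⧸ E n) →+ A n,
      (∀ n, (QuotientAddGroup.mk' (E n)).comp (s n) =
        AddMonoidHom.id (A n ⧸ E n)) ∧
      (∀ n, (d n).comp (s (n+1)) = (s n).comp (dQ n)) ∧
      (∀ (G : Type) [AddCommGroup G] (n : ℕ),
        Nonempty (coefH A d G n ≃+
          coefH (fun n => ↥(E n)) dD G n × coefH (fun n => A n ⧸ E n) dQ G n)) := by
  classical
  let dD : ∀ n, ↥(E (n+1)) →+ ↥(E n) := fun n =>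
    ((d n).comp (E (n+1)).subtype).codRestrict (E n)
      (fun c => hmem n c.1 c.2)
  have hdD : ∀ n, ((E n).subtype).comp (dD n) =
      (d n).comp (E (n+1)).subtype := fun n => rfl
  let dQ : ∀ n, (A (n+1) ⧸ E (n+1)) →+ (A n ⧸ E n) := fun n =>
    QuotientAddGroup.map _ _ (d n) (fun c hc => hmem n c hc)
  have hdQ : ∀ n, (dQ n).comp (QuotientAddGroup.mk' (E (n+1))) =
        (QuotientAddGroup.mk' (E n)).comp (d n) := fun n => rfl
  let s : ∀ n, (A n ⧸ E n) →+ A n := fun n =>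
    QuotientAddGroup.lift _ (σ n) (fun c hc => hD n c hc)
  have hsm : ∀ n (c : A n), s n (QuotientAddGroup.mk' (E n) c) = σ n c :=
    fun n c => rfl
  have hqs : ∀ n, (QuotientAddGroup.mk' (E n)).comp (s n) =
        AddMonoidHom.id (A n ⧸ E n) := by
    intro n
    refine AddMonoidHom.ext fun c => ?_
    obtain ⟨c, rfl⟩ := QuotientAddGroup.mk'_surjective _ c
    rw [AddMonoidHom.comp_apply, hsm, AddMonoidHom.id_apply]
    refine (QuotientAddGroup.eq.mpr ?_)
    rw [neg_add_eq_sub]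
    exact hsub n c
  have hs : ∀ n, (d n).comp (s (n+1)) = (s n).comp (dQ n) := by
    intro n
    refine AddMonoidHom.ext fun c => ?_
    obtain ⟨c, rfl⟩ := QuotientAddGroup.mk'_surjective _ c
    exact hchain n c
  refine ⟨dD, hdD, dQ, hdQ, s, hqs, hs, ?_⟩
  intro G _ n
  let p : ∀ n, A n →+ ↥(E n) := fun n =>
    (AddMonoidHom.id (A n) - σ n).codRestrict (E n)
      (fun c => hsub n c)
  have hpv : ∀ n c, (p n c : A n) = c - σ n c := fun n c => rfl
  refine split_homology (A := A) (B := fun n => A n ⧸ E n) (D := fun n => ↥(E n)) d dQ dD (fun n => (E n).subtype)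
    (fun n => (hdD n).symm) p ?_ (fun n => QuotientAddGroup.mk' (E n)) hdQ s hs
    ?_ hqs ?_ ?_ ?_ G n
  · intro n
    refine AddMonoidHom.ext fun c => Subtype.ext ?_
    change d n (p (n+1) c : A (n+1)) = (p n (d n c) : A n)
    rw [hpv, hpv, map_sub, hchain]
  · intro n
    refine AddMonoidHom.ext fun c => Subtype.ext ?_
    change (p n (c : A n) : A n) = c
    rw [hpv, hD n _ c.2, sub_zero]
  · intro n
    refine AddMonoidHom.ext fun c => Subtype.ext ?_
    change (p n (s n c) : A n) = 0
    rw [hpv, ← hsm]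
    have := DFunLike.congr_fun (hqs n) c
    rw [AddMonoidHom.comp_apply, AddMonoidHom.id_apply] at this
    rw [this, sub_self]
  · intro n
    refine AddMonoidHom.ext fun c => ?_
    exact (QuotientAddGroup.eq_zero_iff _).mpr c.2
  · intro n
    refine AddMonoidHom.ext fun c => ?_
    change (p n c : A n) + s n (QuotientAddGroup.mk' (E n) c) = c
    rw [hsm, hpv, sub_add_cancel]

end homology

end QSplit

/-- For a quandle `X`, the short exact sequence of chain complexes
`0 → C_*^D(X) → C_*^R(X) → C_*^Q(X) → 0` splits in the strong sense: writing `dD`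
for the restricted boundary of the degenerate subcomplex and `dQ` for the induced
boundary of the quotient complex `C_*^Q = C_*^R/C_*^D`, there is a chain map
`s : C_*^Q(X) → C_*^R(X)` (commuting with the boundaries) which is a section of the
quotient chain map.  Consequently, for every abelian group `G` and every `n`,
`H_n^R(X; G) ≅ H_n^D(X; G) ⊕ H_n^Q(X; G)`. -/
theorem stmt11 {X : Type} (op : X → X → X)
    (hQ1 : ∀ a : X, op a a = a)
    (hQ2 : ∀ a b : X, ∃! c : X, a = op c b)
    (hQ3 : ∀ a b c : X, op (op a b) c = op (op a c) (op b c)) :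
    ∃ dD : ∀ n, ↥(DSub X (n+1)) →+ ↥(DSub X n),
      (∀ n, ((DSub X n).subtype).comp (dD n) = (rackD op n).comp (DSub X (n+1)).subtype) ∧
    ∃ dQ : ∀ n, (RC X (n+1) ⧸ DSub X (n+1)) →+ (RC X n ⧸ DSub X n),
      (∀ n, (dQ n).comp (QuotientAddGroup.mk' (DSub X (n+1))) =
        (QuotientAddGroup.mk' (DSub X n)).comp (rackD op n)) ∧
    ∃ s : ∀ n, (RC X n ⧸ DSub X n) →+ RC X n,
      (∀ n, (QuotientAddGroup.mk' (DSub X n)).comp (s n) =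
        AddMonoidHom.id (RC X n ⧸ DSub X n)) ∧
      (∀ n, (rackD op n).comp (s (n+1)) = (s n).comp (dQ n)) ∧
      (∀ (G : Type) [AddCommGroup G] (n : ℕ),
        Nonempty (coefH (RC X) (rackD op) G n ≃+
          coefH (fun n => ↥(DSub X n)) dD G n × coefH (fun n => RC X n ⧸ DSub X n) dQ G n)) := by
  exact QSplit.generic (RC X) (rackD op) (DSub X) (QSplit.sR X) (QSplit.rackD_mem op hQ1)
    (QSplit.sR_chain op hQ1) QSplit.sR_D QSplit.sub_sR_mem
end

section
/- Let X be a quandle. The second integral degeneration homology group H_2^D(X) is isomorphic to the free abelian group ℤ[Orb(X)] on the orbit set of X. Consequently H_2^R(X) ≅ H_2^Q(X) ⊕ ℤ[Orb(X)]. -/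
/-- The integral rack homology group `H_{n+1}^R(X) = ker ∂_{n+1} / im ∂_{n+2}`. -/
abbrev rackH {X : Type} (op : X → X → X) (n : ℕ) : Type :=
  (rackD op n).ker ⧸ ((rackD op (n+1)).range.addSubgroupOf (rackD op n).ker)

/-- The second integral degeneration homology group
`H_2^D(X) = ker(∂_2|_{C_2^D}) / ∂_3(C_3^D)` (computed inside `C_2^R(X)`,
using that the degenerate chains form a subcomplex). -/
abbrev degH2 {X : Type} (op : X → X → X) : Type :=
  ↥(DSub X 2 ⊓ (rackD op 1).ker) ⧸
    ((AddSubgroup.map (rackD op 2) (DSub X 3)).addSubgroupOf (DSub X 2 ⊓ (rackD op 1).ker))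

/-- The second integral quandle homology group, i.e. the degree-2 homology of the
quotient complex `C_*^Q = C_*^R/C_*^D`: `H_2^Q(X) = ∂_2⁻¹(C_1^D) / (im ∂_3 ⊔ C_2^D)`. -/
abbrev quandleH2 {X : Type} (op : X → X → X) : Type :=
  ↥((DSub X 1).comap (rackD op 1)) ⧸
    (((rackD op 2).range ⊔ DSub X 2).addSubgroupOf ((DSub X 1).comap (rackD op 1)))

/-- The orbit set of a rack: the quotient of `X` by the equivalence relation
generated by `x ∼ x * y`. -/
def Orb {X : Type} (op : X → X → X) : Type :=
  Quot (fun a b : X => ∃ y : X, op a y = b)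

/-- The generator of `C_n^R`. -/
def gen2 {X : Type} (a b : X) : RC X 2 := FreeAbelianGroup.of (![a, b] : Fin 2 → X)

def gen3 {X : Type} (a b c : X) : RC X 3 := FreeAbelianGroup.of (![a, b, c] : Fin 3 → X)

def gen1 {X : Type} (a : X) : RC X 1 := FreeAbelianGroup.of (![a] : Fin 1 → X)

/-- The splitting map `(a, b) ↦ [a]`. -/
def phi {X : Type} (op : X → X → X) : RC X 2 →+ FreeAbelianGroup (Orb op) :=
  (FreeAbelianGroup.lift fun x : Fin 2 → X =>
    FreeAbelianGroup.of (Quot.mk _ (x 0) : Orb op) :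
    FreeAbelianGroup (Fin 2 → X) →+ FreeAbelianGroup (Orb op))

theorem phi_gen2 {X : Type} (op : X → X → X) (a b : X) :
    phi op (gen2 a b) = FreeAbelianGroup.of (Quot.mk _ a : Orb op) :=
  FreeAbelianGroup.lift_apply_of _ _

theorem of_fin1 {X : Type} (f : Fin 1 → X) {a : X} (h : f 0 = a) :
    (FreeAbelianGroup.of f : FreeAbelianGroup (Fin 1 → X)) = FreeAbelianGroup.of ![a] := by
  congr 1
  ext j
  fin_cases j
  exact h

theorem of_fin2 {X : Type} (f : Fin 2 → X) {a b : X} (h : f 0 = a) (h' : f 1 = b) :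
    (FreeAbelianGroup.of f : FreeAbelianGroup (Fin 2 → X)) = FreeAbelianGroup.of ![a, b] := by
  congr 1
  ext j
  fin_cases j
  · exact h
  · exact h'

theorem arith1 {A : Type} [AddCommGroup A] (p q q' r : A) (h : q = q') :
    ((-1 : ℤ) ^ (((0 : Fin 2) : ℕ) + 1)) • (q - q') +
      ((-1 : ℤ) ^ (((1 : Fin 2) : ℕ) + 1)) • (p - r) = p - r := by
  simp [h]

theorem arith2 {A : Type} [AddCommGroup A] (p q q' r s t : A) (h : q = q') :
    ((-1 : ℤ) ^ (((0 : Fin 3) : ℕ) + 1)) • (q - q') +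
      ((-1 : ℤ) ^ (((1 : Fin 3) : ℕ) + 1)) • (p - r) +
      ((-1 : ℤ) ^ (((2 : Fin 3) : ℕ) + 1)) • (s - t) = (p - r) - (s - t) := by
  have e : (-1 : ℤ) ^ (((2 : Fin 3) : ℕ) + 1) = -1 := by decide
  rw [e]
  simp [h]
  abel

theorem rackD1_gen2 {X : Type} (op : X → X → X) (a b : X) :
    rackD op 1 (gen2 a b) = gen1 a - gen1 (op a b) := by
  refine (FreeAbelianGroup.lift_apply_of _ _).trans ?_
  refine (Fin.sum_univ_two _).trans ?_
  refine (arith1 _ _ _ _ ?_).trans ?_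
  · rfl
  · exact congrArg₂ (fun u v : FreeAbelianGroup (Fin 1 → X) => u - v)
      (of_fin1 _ rfl) (of_fin1 _ rfl)

theorem of_eq_gen2 {X : Type} (f : Fin 2 → X) :
    (FreeAbelianGroup.of f : FreeAbelianGroup (Fin 2 → X)) = gen2 (f 0) (f 1) := by
  unfold gen2
  congr 1
  ext j
  fin_cases j <;> rfl

theorem of_eq_gen3 {X : Type} (f : Fin 3 → X) :
    (FreeAbelianGroup.of f : FreeAbelianGroup (Fin 3 → X)) = gen3 (f 0) (f 1) (f 2) := by
  unfold gen3
  congr 1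
  ext j
  fin_cases j <;> rfl

theorem rackD2_gen3 {X : Type} (op : X → X → X) (a b c : X) :
    rackD op 2 (gen3 a b c) =
      (gen2 a c - gen2 (op a b) c) - (gen2 a b - gen2 (op a c) (op b c)) := by
  refine (FreeAbelianGroup.lift_apply_of _ _).trans ?_
  refine (Fin.sum_univ_three _).trans ?_
  refine (arith2 _ _ _ _ _ _ ?_).trans ?_
  · rfl
  · exact congrArg₂ (fun u v : FreeAbelianGroup (Fin 2 → X) => u - v)
      (congrArg₂ (fun u v : FreeAbelianGroup (Fin 2 → X) => u - v)
        (of_fin2 _ rfl rfl) (of_fin2 _ rfl rfl))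
      (congrArg₂ (fun u v : FreeAbelianGroup (Fin 2 → X) => u - v)
        (of_fin2 _ rfl rfl) (of_fin2 _ rfl rfl))

theorem gen2_mem {X : Type} (a : X) : gen2 a a ∈ DSub X 2 :=
  AddSubgroup.subset_closure ⟨_, ⟨0, 1, rfl, rfl⟩, rfl⟩

theorem gen3_mem {X : Type} (a c : X) : gen3 a a c ∈ DSub X 3 :=
  AddSubgroup.subset_closure ⟨_, ⟨0, 1, rfl, rfl⟩, rfl⟩

theorem fin2_aux : ∀ i j : Fin 2, (i : ℕ) + 1 = (j : ℕ) → i = 0 ∧ j = 1 := by decide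

theorem fin1_aux : ∀ i j : Fin 1, (i : ℕ) + 1 = (j : ℕ) → False := by decide

theorem DSub2_ind {X : Type} (S : AddSubgroup (RC X 2)) (h : ∀ a, gen2 a a ∈ S) :
    DSub X 2 ≤ S := by
  refine (AddSubgroup.closure_le (G := FreeAbelianGroup (Fin 2 → X)) S).2 ?_
  rintro _ ⟨x, ⟨i, j, hij, hx⟩, rfl⟩
  obtain ⟨hi, hj⟩ := fin2_aux i j hij
  subst hi hj
  rw [of_eq_gen2, hx]
  exact h _

theorem DSub1_eq {X : Type} : DSub X 1 = ⊥ := by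
  refine le_bot_iff.1 ?_
  refine (AddSubgroup.closure_le (G := FreeAbelianGroup (Fin 1 → X)) ⊥).2 ?_
  rintro _ ⟨x, ⟨i, j, hij, hx⟩, rfl⟩
  exact (fin1_aux i j hij).elim

theorem RC3_hom_ext {X G : Type} [AddCommGroup G] (f g : RC X 3 →+ G)
    (h : ∀ a b c, f (gen3 a b c) = g (gen3 a b c)) : f = g :=
  FreeAbelianGroup.lift_ext (α := Fin 3 → X) f g fun x => by
    rw [of_eq_gen3]; exact h _ _ _

theorem phi_rackD2 {X : Type} (op : X → X → X) (z : RC X 3) : phi op (rackD op 2 z) = 0 := by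
  have : (phi op).comp (rackD op 2) = 0 := by
    apply RC3_hom_ext
    intro a b c
    have e : ∀ y, (Quot.mk _ (op a y) : Orb op) = Quot.mk _ a := fun y =>
      (Quot.sound ⟨y, rfl⟩).symm
    rw [AddMonoidHom.comp_apply, rackD2_gen3]
    simp [phi_gen2, e]
  exact DFunLike.congr_fun this z

/-- Inverse map. -/
def psi {X : Type} (op : X → X → X) (hQ1 : ∀ a : X, op a a = a) :
    FreeAbelianGroup (Orb op) →+ RC X 2 ⧸ AddSubgroup.map (rackD op 2) (DSub X 3) :=
  FreeAbelianGroup.lift (Quot.lift (fun a => QuotientAddGroup.mk (gen2 a a)) (by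
    rintro a _ ⟨y, rfl⟩
    refine QuotientAddGroup.eq.2 ⟨gen3 a a y, gen3_mem a y, ?_⟩
    rw [rackD2_gen3, hQ1]
    abel))

theorem mem_of_phi {X : Type} (op : X → X → X) (hQ1 : ∀ a : X, op a a = a)
    {d : RC X 2} (hd : d ∈ DSub X 2) (h : phi op d = 0) :
    d ∈ AddSubgroup.map (rackD op 2) (DSub X 3) := by
  have key : DSub X 2 ≤ ((psi op hQ1).comp (phi op)).eqLocus (QuotientAddGroup.mk' _) := by
    apply DSub2_ind
    intro a
    change psi op hQ1 (phi op (gen2 a a)) = _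
    rw [phi_gen2]
    exact FreeAbelianGroup.lift_apply_of _ _
  have k : psi op hQ1 (phi op d) = QuotientAddGroup.mk d := key hd
  rw [h, map_zero] at k
  exact (QuotientAddGroup.eq_zero_iff d).1 k.symm

theorem DSub2_le_ker {X : Type} (op : X → X → X) (hQ1 : ∀ a : X, op a a = a) :
    DSub X 2 ≤ (rackD op 1).ker := by
  apply DSub2_ind
  intro a
  rw [AddMonoidHom.mem_ker, rackD1_gen2, hQ1, sub_self]

theorem phi_surj {X : Type} (op : X → X → X) (w : FreeAbelianGroup (Orb op)) :
    ∃ d ∈ DSub X 2, phi op d = w := by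
  have : w ∈ AddSubgroup.map (phi op) (DSub X 2) := by
    induction w using FreeAbelianGroup.induction_on with
    | zero => exact zero_mem _
    | of x =>
      obtain ⟨a, rfl⟩ := Quot.exists_rep x
      exact ⟨_, gen2_mem a, phi_gen2 op a a⟩
    | neg x hx => exact neg_mem hx
    | add x y hx hy => exact add_mem hx hy
  exact this

theorem quot_equiv {A G : Type} [AddCommGroup A] [AddCommGroup G] (N : AddSubgroup A)
    (f : A →+ G) (hf : Function.Surjective f) (h : ∀ a, a ∈ N ↔ f a = 0) :
    Nonempty (A ⧸ N ≃+ G) := by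
  have : N = f.ker := by ext a; exact h a
  subst this
  exact ⟨QuotientAddGroup.quotientKerEquivOfSurjective f hf⟩

/-- For a quandle `X`, `H_2^D(X) ≅ ℤ[Orb(X)]`, and consequently
`H_2^R(X) ≅ H_2^Q(X) ⊕ ℤ[Orb(X)]`. -/
theorem stmt13 {X : Type} (op : X → X → X)
    (hQ1 : ∀ a : X, op a a = a)
    (hQ2 : ∀ a b : X, ∃! c : X, a = op c b)
    (hQ3 : ∀ a b c : X, op (op a b) c = op (op a c) (op b c)) :
    Nonempty (degH2 op ≃+ FreeAbelianGroup (Orb op)) ∧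
      Nonempty (rackH op 1 ≃+ quandleH2 op × FreeAbelianGroup (Orb op)) := by

  constructor
  · refine quot_equiv _ ((phi op).comp (AddSubgroup.subtype _)) ?_ ?_
    · intro w
      obtain ⟨d, hd, h⟩ := phi_surj op w
      exact ⟨⟨d, hd, DSub2_le_ker op hQ1 hd⟩, h⟩
    · rintro ⟨d, hd, hk⟩
      rw [AddSubgroup.mem_addSubgroupOf]
      constructor
      · rintro ⟨z, -, hz⟩
        change phi op d = 0
        rw [← show rackD op 2 z = d from hz]
        exact phi_rackD2 op z
      · intro h
        exact mem_of_phi op hQ1 hd h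
  · have hle : (rackD op 1).ker ≤ (DSub X 1).comap (rackD op 1) := by
      intro z hz
      rw [AddSubgroup.mem_comap, AddMonoidHom.mem_ker.1 hz]
      exact zero_mem _
    have hge : (DSub X 1).comap (rackD op 1) ≤ (rackD op 1).ker := by
      intro z hz
      rw [AddSubgroup.mem_comap, DSub1_eq] at hz
      exact hz
    refine quot_equiv _ (((QuotientAddGroup.mk' _).comp (AddSubgroup.inclusion hle)).prod
      ((phi op).comp (AddSubgroup.subtype _))) ?_ ?_
    · rintro ⟨q, w⟩
      obtain ⟨⟨z, hz⟩, rfl⟩ := QuotientAddGroup.mk_surjective q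
      obtain ⟨d, hd, h⟩ := phi_surj op (w - phi op z)
      refine ⟨⟨z + d, add_mem (hge hz) (DSub2_le_ker op hQ1 hd)⟩, Prod.ext ?_ ?_⟩
      · refine QuotientAddGroup.eq.2 ?_
        rw [AddSubgroup.mem_addSubgroupOf]
        change -(z + d) + z ∈ _
        have : -(z + d) + z = -d := by abel
        rw [this]
        exact neg_mem (AddSubgroup.mem_sup_right hd)
      · change phi op (z + d) = w
        rw [map_add, h]
        abel
    · rintro ⟨z, hz⟩
      rw [AddSubgroup.mem_addSubgroupOf]
      constructor
      · intro hb
        refine Prod.ext ?_ ?_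
        · refine (QuotientAddGroup.eq_zero_iff _).2 ?_
          rw [AddSubgroup.mem_addSubgroupOf]
          exact AddSubgroup.mem_sup_left hb
        · obtain ⟨y, hy⟩ := hb
          change phi op z = 0
          rw [← show rackD op 2 y = z from hy]
          exact phi_rackD2 op y
      · intro h
        have h1 := (QuotientAddGroup.eq_zero_iff _).1 (congrArg Prod.fst h)
        have h2 : phi op z = 0 := congrArg Prod.snd h
        rw [AddSubgroup.mem_addSubgroupOf] at h1
        obtain ⟨b, hb, d, hd, hbd⟩ := AddSubgroup.mem_sup.1 h1
        replace hbd : b + d = z := hbd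
        change z ∈ (rackD op 2).range
        rw [← hbd]
        refine add_mem hb ?_
        obtain ⟨y, rfl⟩ := hb
        rw [← hbd, map_add, phi_rackD2, zero_add] at h2
        obtain ⟨t, -, ht⟩ := mem_of_phi op hQ1 hd h2
        exact ⟨t, ht⟩
end

section
/- Let X be a quandle. Then H_3^R(X) ≅ H_3^Q(X) ⊕ H_2^Q(X) ⊕ ℤ[Orb(X) × Orb(X)], where ℤ[Orb(X) × Orb(X)] is the free abelian group on the set of pairs of orbits of X. -/
/-- The integral quandle homology group `H_{n+1}^Q(X)`, i.e. the degree-`n+1`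
homology of the quotient complex `C_*^Q = C_*^R/C_*^D`:
`H_{n+1}^Q(X) = ∂_{n+1}⁻¹(C_n^D) / (im ∂_{n+2} ⊔ C_{n+1}^D)`. -/
abbrev quandleH {X : Type} (op : X → X → X) (n : ℕ) : Type :=
  ↥((DSub X n).comap (rackD op n)) ⧸
    (((rackD op (n+1)).range ⊔ DSub X (n+1)).addSubgroupOf ((DSub X n).comap (rackD op n)))

namespace S14

theorem abstractIso {C1 C2 C3 C4 E F : Type} [AddCommGroup C1] [AddCommGroup C2]
    [AddCommGroup C3] [AddCommGroup C4] [AddCommGroup E] [AddCommGroup F]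
    (d2 : C2 →+ C1) (d3 : C3 →+ C2) (d4 : C4 →+ C3)
    (D1 : AddSubgroup C1) (D2 : AddSubgroup C2) (D3 : AddSubgroup C3)
    (a2 : C2 →+ C2) (a3 : C3 →+ C3) (a4 : C4 →+ C4)
    (p2 : C2 →+ C1) (p3 : C3 →+ C2) (p4 : C4 →+ C3)
    (S1 : C1 →+ C2) (S2 : C2 →+ C3) (S3 : C3 →+ C4)
    (l : C3 →+ E) (T : F →+ C3) (q : F →+ E) (m : C3 →+ F)
    (hD1 : D1 = ⊥)
    (ha3 : ∀ c, d3 (a3 c) = a2 (d3 c)) (ha4 : ∀ c, d4 (a4 c) = a3 (d4 c))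
    (haD2 : ∀ c ∈ D2, a2 c = 0) (haD3 : ∀ c ∈ D3, a3 c = 0)
    (hasub : ∀ c, a3 c - c ∈ D3)
    (hS2 : ∀ c, d3 (S2 c) = - S1 (d2 c)) (hS3 : ∀ c, d4 (S3 c) = - S2 (d3 c))
    (hSD : ∀ c ∈ D2, S2 c = 0) (hSm : ∀ c, S2 c ∈ D3)
    (hp3 : ∀ c, d2 (p3 c) = - p2 (d3 c)) (hp4 : ∀ c, d3 (p4 c) = - p3 (d4 c))
    (hpS : ∀ c, p3 (S2 c) - c ∈ D2) (hpa : ∀ c, p3 (a3 c) = 0)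
    (hla : ∀ c, l (a3 c) = 0) (hlS : ∀ c, l (S2 c) = 0) (hld : ∀ c, l (d4 c) = 0)
    (hq : Function.Surjective q) (hpT : ∀ f, p3 (T f) = 0) (hlT : ∀ f, l (T f) = q f)
    (hdT : ∀ f, d3 (T f) = 0) (hTD : ∀ f, T f ∈ D3)
    (hid : ∀ c, c = a3 c + S2 (p3 c) + T (m c))
    (hTl : ∀ c, l c = 0 → T (m c) ∈ d4.range) :
    Nonempty ((d3.ker ⧸ d4.range.addSubgroupOf d3.ker) ≃+
      (↥(D2.comap d3) ⧸ (d4.range ⊔ D3).addSubgroupOf (D2.comap d3)) ×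
      (↥(D1.comap d2) ⧸ (d3.range ⊔ D2).addSubgroupOf (D1.comap d2)) × E) := by
  have e1 : ∀ c : d3.ker, (c : C3) ∈ D2.comap d3 := fun c => by
    have : d3 c = 0 := c.2
    simp [AddSubgroup.mem_comap, this]
  have e2 : ∀ c : d3.ker, p3 (c : C3) ∈ D1.comap d2 := fun c => by
    have : d3 c = 0 := c.2
    simp [AddSubgroup.mem_comap, hp3, this]
  let f1 : d3.ker →+ ↥(D2.comap d3) := d3.ker.subtype.codRestrict _ e1
  let f2 : d3.ker →+ ↥(D1.comap d2) := (p3.comp d3.ker.subtype).codRestrict _ e2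
  let G := (QuotientAddGroup.mk' ((d4.range ⊔ D3).addSubgroupOf (D2.comap d3))).comp f1
  let H := (QuotientAddGroup.mk' ((d3.range ⊔ D2).addSubgroupOf (D1.comap d2))).comp f2
  let Ψ := G.prod (H.prod (l.comp d3.ker.subtype))
  have hG : ∀ c, G c = 0 ↔ (c : C3) ∈ d4.range ⊔ D3 := fun c => by
    change QuotientAddGroup.mk (f1 c) = 0 ↔ _
    rw [QuotientAddGroup.eq_zero_iff, AddSubgroup.mem_addSubgroupOf]; rfl
  have hH : ∀ c, H c = 0 ↔ p3 (c : C3) ∈ d3.range ⊔ D2 := fun c => by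
    change QuotientAddGroup.mk (f2 c) = 0 ↔ _
    rw [QuotientAddGroup.eq_zero_iff, AddSubgroup.mem_addSubgroupOf]; rfl
  have hker : d4.range.addSubgroupOf d3.ker = Ψ.ker := by
    ext c
    rw [AddSubgroup.mem_addSubgroupOf, AddMonoidHom.mem_ker]
    have : Ψ c = 0 ↔ G c = 0 ∧ H c = 0 ∧ l c = 0 := by
      change (G c, H c, l c) = 0 ↔ _
      simp [Prod.ext_iff]
    rw [this, hG, hH]
    constructor
    · rintro ⟨b, hb⟩
      refine ⟨AddSubgroup.mem_sup_left ⟨b, hb⟩, AddSubgroup.mem_sup_left ⟨- p4 b, ?_⟩, ?_⟩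
      · rw [map_neg, hp4, neg_neg, hb]
      · rw [← hb, hld]
    · rintro ⟨h1, h2, h3⟩
      rw [hid c]
      refine add_mem (add_mem ?_ ?_) (hTl _ h3)
      · obtain ⟨_, ⟨b, rfl⟩, z, hz, h⟩ := AddSubgroup.mem_sup.1 h1
        rw [← h, map_add, haD3 z hz, add_zero, ← ha4]
        exact ⟨_, rfl⟩
      · obtain ⟨_, ⟨b, rfl⟩, z, hz, h⟩ := AddSubgroup.mem_sup.1 h2
        rw [← h, map_add, hSD z hz, add_zero]
        exact ⟨- S3 b, by rw [map_neg, hS3, neg_neg]⟩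
  have hsurj : Function.Surjective Ψ := by
    rintro ⟨x, y, z⟩
    obtain ⟨⟨x, hx⟩, rfl⟩ := QuotientAddGroup.mk_surjective x
    obtain ⟨⟨y, hy⟩, rfl⟩ := QuotientAddGroup.mk_surjective y
    obtain ⟨f, rfl⟩ := hq z
    have hy' : d2 y = 0 := by simpa [hD1] using hy
    have hc : a3 x + S2 y + T f ∈ d3.ker := by
      rw [AddMonoidHom.mem_ker, map_add, map_add, ha3, haD2 _ hx, hS2, hy', hdT]
      simp
    refine ⟨⟨_, hc⟩, ?_⟩
    refine Prod.ext ?_ (Prod.ext ?_ ?_)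
    · refine (QuotientAddGroup.eq.2 ?_).symm
      rw [AddSubgroup.mem_addSubgroupOf]
      refine AddSubgroup.mem_sup_right ?_
      have := add_mem (add_mem (hasub x) (hSm y)) (hTD f)
      convert this using 1
      change -x + (a3 x + S2 y + T f) = _
      abel
    · refine (QuotientAddGroup.eq.2 ?_).symm
      rw [AddSubgroup.mem_addSubgroupOf]
      refine AddSubgroup.mem_sup_right ?_
      convert hpS y using 1
      change -y + p3 (a3 x + S2 y + T f) = _
      rw [map_add, map_add, hpa, hpT]
      abel
    · change l (a3 x + S2 y + T f) = _
      rw [map_add, map_add, hla, hlS, hlT]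
      simp
  exact ⟨(QuotientAddGroup.quotientAddEquivOfEq hker).trans
    (QuotientAddGroup.quotientKerEquivOfSurjective Ψ hsurj)⟩

open FreeAbelianGroup

variable {X : Type}

/-- Free abelian group on `n`-tuples. -/
abbrev Fr (X : Type) (n : ℕ) := FreeAbelianGroup (Fin n → X)

def g1 (x : X) : Fr X 1 := of ![x]
def g2 (x y : X) : Fr X 2 := of ![x, y]
def g3 (x y z : X) : Fr X 3 := of ![x, y, z]
def g4 (x y z w : X) : Fr X 4 := of ![x, y, z, w]

def l1 {A : Type} [AddCommGroup A] (f : X → A) : Fr X 1 →+ A := lift fun v => f (v 0)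
def l2 {A : Type} [AddCommGroup A] (f : X → X → A) : Fr X 2 →+ A :=
  lift fun v => f (v 0) (v 1)
def l3 {A : Type} [AddCommGroup A] (f : X → X → X → A) : Fr X 3 →+ A :=
  lift fun v => f (v 0) (v 1) (v 2)
def l4 {A : Type} [AddCommGroup A] (f : X → X → X → X → A) : Fr X 4 →+ A :=
  lift fun v => f (v 0) (v 1) (v 2) (v 3)

@[simp] theorem l1_g {A : Type} [AddCommGroup A] (f : X → A) (x : X) :
    l1 f (g1 x) = f x := by simp [l1, g1]
@[simp] theorem l2_g {A : Type} [AddCommGroup A] (f : X → X → A) (x y : X) :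
    l2 f (g2 x y) = f x y := by simp [l2, g2]
@[simp] theorem l3_g {A : Type} [AddCommGroup A] (f : X → X → X → A) (x y z : X) :
    l3 f (g3 x y z) = f x y z := by simp [l3, g3]
@[simp] theorem l4_g {A : Type} [AddCommGroup A] (f : X → X → X → X → A) (x y z w : X) :
    l4 f (g4 x y z w) = f x y z w := by simp [l4, g4]

theorem hom_ext2 {A : Type} [AddCommGroup A] {f g : Fr X 2 →+ A}
    (h : ∀ x y, f (g2 x y) = g (g2 x y)) (c : Fr X 2) : f c = g c := by
  refine DFunLike.congr_fun (FreeAbelianGroup.lift_ext _ _ fun v => ?_) c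
  have : v = ![v 0, v 1] := by ext i; fin_cases i <;> rfl
  rw [this]; exact h _ _
theorem hom_ext3 {A : Type} [AddCommGroup A] {f g : Fr X 3 →+ A}
    (h : ∀ x y z, f (g3 x y z) = g (g3 x y z)) (c : Fr X 3) : f c = g c := by
  refine DFunLike.congr_fun (FreeAbelianGroup.lift_ext _ _ fun v => ?_) c
  have : v = ![v 0, v 1, v 2] := by ext i; fin_cases i <;> rfl
  rw [this]; exact h _ _ _
theorem hom_ext4 {A : Type} [AddCommGroup A] {f g : Fr X 4 →+ A}
    (h : ∀ x y z w, f (g4 x y z w) = g (g4 x y z w)) (c : Fr X 4) : f c = g c := by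
  refine DFunLike.congr_fun (FreeAbelianGroup.lift_ext _ _ fun v => ?_) c
  have : v = ![v 0, v 1, v 2, v 3] := by ext i; fin_cases i <;> rfl
  rw [this]; exact h _ _ _ _

def D2 (X : Type) : AddSubgroup (Fr X 2) := DSub X 2
def D3 (X : Type) : AddSubgroup (Fr X 3) := DSub X 3

theorem mem_D2 (x : X) : g2 x x ∈ D2 X :=
  AddSubgroup.subset_closure ⟨_, ⟨0, 1, rfl, rfl⟩, rfl⟩
theorem mem_D3 (x y : X) : g3 x x y ∈ D3 X :=
  AddSubgroup.subset_closure ⟨_, ⟨0, 1, rfl, rfl⟩, rfl⟩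
theorem mem_D3' (x y : X) : g3 x y y ∈ D3 X :=
  AddSubgroup.subset_closure ⟨_, ⟨1, 2, rfl, rfl⟩, rfl⟩

theorem D2_kill {A : Type} [AddCommGroup A] (f : Fr X 2 →+ A) (h : ∀ x, f (g2 x x) = 0) :
    ∀ c ∈ D2 X, f c = 0 := by
  intro c hc
  have : D2 X ≤ f.ker := by
    refine (AddSubgroup.closure_le _).2 ?_
    rintro _ ⟨v, ⟨i, j, hij, hv⟩, rfl⟩
    have e : v = ![v 0, v 1] := by ext i; fin_cases i <;> rfl
    have e2 : v 1 = v 0 := by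
      clear e
      fin_cases i <;> fin_cases j <;> simp_all
    rw [e, e2]
    exact h _
  exact this hc
theorem D3_kill {A : Type} [AddCommGroup A] (f : Fr X 3 →+ A) (h : ∀ x y, f (g3 x x y) = 0)
    (h' : ∀ x y, f (g3 x y y) = 0) : ∀ c ∈ D3 X, f c = 0 := by
  intro c hc
  have : D3 X ≤ f.ker := by
    refine (AddSubgroup.closure_le _).2 ?_
    rintro _ ⟨v, ⟨i, j, hij, hv⟩, rfl⟩
    have e : v = ![v 0, v 1, v 2] := by ext i; fin_cases i <;> rfl
    have e2 : v 1 = v 0 ∨ v 2 = v 1 := by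
      clear e
      fin_cases i <;> fin_cases j <;> simp_all
    rw [e]
    rcases e2 with e2 | e2 <;> rw [e2]
    · exact h _ _
    · exact h' _ _
  exact this hc

theorem mem_of2 (f : Fr X 2 →+ Fr X 2) (D : AddSubgroup (Fr X 2))
    (h : ∀ x y, f (g2 x y) ∈ D) (c : Fr X 2) : f c ∈ D := by
  have := hom_ext2 (f := (QuotientAddGroup.mk' D).comp f) (g := 0)
    (fun x y => (QuotientAddGroup.eq_zero_iff _).2 (h x y)) c
  exact (QuotientAddGroup.eq_zero_iff _).1 this
theorem mem_of23 (f : Fr X 2 →+ Fr X 3) (D : AddSubgroup (Fr X 3))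
    (h : ∀ x y, f (g2 x y) ∈ D) (c : Fr X 2) : f c ∈ D := by
  have := hom_ext2 (f := (QuotientAddGroup.mk' D).comp f) (g := 0)
    (fun x y => (QuotientAddGroup.eq_zero_iff _).2 (h x y)) c
  exact (QuotientAddGroup.eq_zero_iff _).1 this
theorem mem_of3 (f : Fr X 3 →+ Fr X 3) (D : AddSubgroup (Fr X 3))
    (h : ∀ x y z, f (g3 x y z) ∈ D) (c : Fr X 3) : f c ∈ D := by
  have := hom_ext3 (f := (QuotientAddGroup.mk' D).comp f) (g := 0)
    (fun x y z => (QuotientAddGroup.eq_zero_iff _).2 (h x y z)) c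
  exact (QuotientAddGroup.eq_zero_iff _).1 this

variable (op : X → X → X)

def d2 : Fr X 2 →+ Fr X 1 := rackD op 1
def d3 : Fr X 3 →+ Fr X 2 := rackD op 2
def d4 : Fr X 4 →+ Fr X 3 := rackD op 3

theorem d2_g (x y : X) : d2 op (g2 x y) = g1 x - g1 (op x y) := by
  refine (FreeAbelianGroup.lift_apply_of _ _).trans ?_
  have h : ∀ v : Fin 1 → X, of v = g1 (v 0) := fun v => by
    rw [g1]; congr 1; ext i; fin_cases i <;> rfl
  simp only [h, Fin.sum_univ_succ, Finset.univ_eq_empty, Finset.sum_empty]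
  simp [Fin.succAbove, Fin.lt_def]
theorem d3_g (x y z : X) : d3 op (g3 x y z) =
    (g2 x z - g2 (op x y) z) - (g2 x y - g2 (op x z) (op y z)) := by
  refine (FreeAbelianGroup.lift_apply_of _ _).trans ?_
  have h : ∀ v : Fin 2 → X, of v = g2 (v 0) (v 1) := fun v => by
    rw [g2]; congr 1; ext i; fin_cases i <;> rfl
  simp only [h, Fin.sum_univ_succ, Finset.univ_eq_empty, Finset.sum_empty]
  simp [Fin.succAbove, Fin.lt_def]
  try abel
theorem d4_g (x y z w : X) : d4 op (g4 x y z w) =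
    (g3 x z w - g3 (op x y) z w) - (g3 x y w - g3 (op x z) (op y z) w)
      + (g3 x y z - g3 (op x w) (op y w) (op z w)) := by
  refine (FreeAbelianGroup.lift_apply_of _ _).trans ?_
  have h : ∀ v : Fin 3 → X, of v = g3 (v 0) (v 1) (v 2) := fun v => by
    rw [g3]; congr 1; ext i; fin_cases i <;> rfl
  simp only [h, Fin.sum_univ_succ, Finset.univ_eq_empty, Finset.sum_empty]
  simp [Fin.succAbove, Fin.lt_def]
  try abel

def a2 (X : Type) : Fr X 2 →+ Fr X 2 := l2 fun x y => g2 x y - g2 x x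
def a3 (X : Type) : Fr X 3 →+ Fr X 3 := l3 fun x y z => g3 x y z - g3 x y y - g3 x x z + g3 x x y
def a4 (X : Type) : Fr X 4 →+ Fr X 4 := l4 fun x y z w =>
  (g4 x y z w - g4 x y y w - g4 x x z w + g4 x x y w) -
  (g4 x y z z - g4 x y y z - g4 x x z z + g4 x x y z)
def p2 (X : Type) : Fr X 2 →+ Fr X 1 := l2 fun x _ => g1 x
def p3 (X : Type) : Fr X 3 →+ Fr X 2 := l3 fun x y z => g2 x z - g2 x y
def p4 (X : Type) : Fr X 4 →+ Fr X 3 := l4 fun x y z w => g3 x z w - g3 x y w + g3 x y z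
def S1 (X : Type) : Fr X 1 →+ Fr X 2 := l1 fun x => g2 x x
def S2 (X : Type) : Fr X 2 →+ Fr X 3 := l2 fun x y => g3 x x y - g3 x x x
def S3 (X : Type) : Fr X 3 →+ Fr X 4 := l3 fun x y z =>
  g4 x x y z - g4 x x y y - g4 x x x z + g4 x x x y
def ll : Fr X 3 →+ FreeAbelianGroup (Orb op × Orb op) :=
  l3 fun x y _ => of (Quot.mk _ x, Quot.mk _ y)
def T (X : Type) : Fr X 2 →+ Fr X 3 := l2 fun x y => g3 x y y
def m (X : Type) : Fr X 3 →+ Fr X 2 := l3 fun x y _ => g2 x y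
def q : Fr X 2 →+ FreeAbelianGroup (Orb op × Orb op) :=
  l2 fun x y => of (Quot.mk _ x, Quot.mk _ y)

theorem orb_op (x y : X) : (Quot.mk _ (op x y) : Orb op) = Quot.mk _ x :=
  (Quot.sound ⟨y, rfl⟩).symm

theorem rel1 (hQ1 : ∀ a : X, op a a = a) (x y z : X) :
    g3 x z z - g3 (op x y) z z ∈ (d4 op).range :=
  ⟨g4 x y z z, by rw [d4_g, hQ1]; abel⟩
theorem rel2 (hQ1 : ∀ a : X, op a a = a) (x y z : X) :
    g3 x y y - g3 x (op y z) (op y z) ∈ (d4 op).range := by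
  have h1 : g3 x y y - g3 (op x z) (op y z) (op y z) ∈ (d4 op).range :=
    ⟨g4 x y y z, by rw [d4_g, hQ1]; abel⟩
  have h2 := rel1 op hQ1 x z (op y z)
  convert sub_mem h1 h2 using 1
  abel

theorem q_surj : Function.Surjective (q op) := by
  intro e
  induction e using FreeAbelianGroup.induction_on with
  | zero => exact ⟨0, map_zero _⟩
  | of x =>
    obtain ⟨⟨x⟩, ⟨y⟩⟩ := x
    exact ⟨g2 x y, by simp [q]⟩
  | neg x h => obtain ⟨f, hf⟩ := h; exact ⟨-f, by rw [map_neg, hf]⟩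
  | add x y h h' =>
    obtain ⟨f, hf⟩ := h
    obtain ⟨f', hf'⟩ := h'
    exact ⟨f + f', by rw [map_add, hf, hf']⟩

theorem T_mem (hQ1 : ∀ a : X, op a a = a) (c : Fr X 3) (hc : ll op c = 0) :
    T X (m X c) ∈ (d4 op).range := by
  let φ : Orb op → Orb op → Fr X 3 ⧸ (d4 op).range :=
    Quot.lift (fun x => Quot.lift (fun y => QuotientAddGroup.mk (g3 x y y)) (by
      rintro y _ ⟨z, rfl⟩
      refine (QuotientAddGroup.eq.2 ?_).symm
      convert rel2 op hQ1 x y z using 1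
      abel)) (by
      rintro x _ ⟨z, rfl⟩
      funext y
      induction y using Quot.ind with | mk y => ?_
      refine (QuotientAddGroup.eq.2 ?_).symm
      convert rel1 op hQ1 x z y using 1
      abel)
  have := hom_ext3 (f := (QuotientAddGroup.mk' (d4 op).range).comp ((T X).comp (m X)))
    (g := (FreeAbelianGroup.lift fun e : Orb op × Orb op => φ e.1 e.2).comp (ll op))
    (fun x y z => by simp [T, m, ll, φ]) c
  simp only [AddMonoidHom.comp_apply, hc, map_zero] at this
  exact (QuotientAddGroup.eq_zero_iff _).1 this

theorem D1_bot : DSub X 1 = ⊥ := by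
  refine (AddSubgroup.closure_eq_bot_iff).2 ?_
  rintro _ ⟨v, ⟨i, j, hij, hv⟩, rfl⟩
  have h1 : (i : ℕ) < 1 := i.2
  have h2 : (j : ℕ) < 1 := j.2
  exact absurd hij (by omega)

theorem main (hQ1 : ∀ a : X, op a a = a) :
    Nonempty (((d3 op).ker ⧸ (d4 op).range.addSubgroupOf (d3 op).ker) ≃+
      (↥((D2 X).comap (d3 op)) ⧸ ((d4 op).range ⊔ D3 X).addSubgroupOf ((D2 X).comap (d3 op))) ×
      (↥(AddSubgroup.comap (d2 op) (DSub X 1)) ⧸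
        ((d3 op).range ⊔ D2 X).addSubgroupOf (AddSubgroup.comap (d2 op) (DSub X 1))) ×
      FreeAbelianGroup (Orb op × Orb op)) := by
  apply abstractIso (d2 op) (d3 op) (d4 op) (DSub X 1) (D2 X) (D3 X) (a2 X) (a3 X) (a4 X)
    (p2 X) (p3 X) (p4 X) (S1 X) (S2 X) (S3 X) (ll op) (T X) (q op) (m X) D1_bot
  · exact hom_ext3 (f := (d3 op).comp (a3 X)) (g := (a2 X).comp (d3 op)) fun x y z => by
      simp [a3, a2, d3_g, hQ1]; try abel
  · exact hom_ext4 (f := (d4 op).comp (a4 X)) (g := (a3 X).comp (d4 op)) fun x y z w => by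
      simp [a3, a4, d4_g, hQ1]; try abel
  · exact D2_kill _ fun x => by simp [a2]
  · exact D3_kill _ (fun x y => by simp [a3]) (fun x y => by simp [a3])
  · refine mem_of3 (a3 X - AddMonoidHom.id _) _ fun x y z => ?_
    have := add_mem (neg_mem (add_mem (mem_D3' x y) (mem_D3 x z))) (mem_D3 x y)
    convert this using 1
    simp [a3]; abel
  · exact hom_ext2 (f := (d3 op).comp (S2 X)) (g := -((S1 X).comp (d2 op))) fun x y => by
      simp [S1, S2, d2_g, d3_g, hQ1]; try abel
  · exact hom_ext3 (f := (d4 op).comp (S3 X)) (g := -((S2 X).comp (d3 op))) fun x y z => by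
      simp [S3, S2, d4_g, d3_g, hQ1]; try abel
  · exact D2_kill _ fun x => by simp [S2]
  · exact mem_of23 _ _ fun x y => by
      simpa [S2] using sub_mem (mem_D3 x y) (mem_D3 x x)
  · exact hom_ext3 (f := (d2 op).comp (p3 X)) (g := -((p2 X).comp (d3 op))) fun x y z => by
      simp [p3, p2, d2_g, d3_g]; try abel
  · exact hom_ext4 (f := (d3 op).comp (p4 X)) (g := -((p3 X).comp (d4 op))) fun x y z w => by
      simp [p3, p4, d4_g, d3_g]; try abel
  · refine mem_of2 ((p3 X).comp (S2 X) - AddMonoidHom.id _) _ fun x y => ?_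
    convert neg_mem (mem_D2 x) using 1
    simp [p3, S2]
  · exact hom_ext3 (f := (p3 X).comp (a3 X)) (g := 0) fun x y z => by
      simp [p3, a3]
  · exact hom_ext3 (f := (ll op).comp (a3 X)) (g := 0) fun x y z => by
      simp [ll, a3]
  · exact hom_ext2 (f := (ll op).comp (S2 X)) (g := 0) fun x y => by
      simp [ll, S2]
  · exact hom_ext4 (f := (ll op).comp (d4 op)) (g := 0) fun x y z w => by
      simp [ll, d4_g, orb_op]
  · exact q_surj op
  · exact hom_ext2 (f := (p3 X).comp (T X)) (g := 0) fun x y => by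
      simp [p3, T]
  · exact hom_ext2 (f := (ll op).comp (T X)) (g := q op) fun x y => by
      simp [ll, T, q]
  · exact hom_ext2 (f := (d3 op).comp (T X)) (g := 0) fun x y => by
      simp [d3_g, T, hQ1]
  · exact mem_of23 _ _ fun x y => by
      simpa [T] using mem_D3' x y
  · exact hom_ext3 (f := AddMonoidHom.id _)
      (g := a3 X + (S2 X).comp (p3 X) + (T X).comp (m X)) fun x y z => by
      simp [a3, S2, p3, T, m]; try abel
  · exact T_mem op hQ1

end S14

/-- For a quandle `X`,
`H_3^R(X) ≅ H_3^Q(X) ⊕ H_2^Q(X) ⊕ ℤ[Orb(X) × Orb(X)]`. -/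
theorem stmt14 {X : Type} (op : X → X → X)
    (hQ1 : ∀ a : X, op a a = a)
    (hQ2 : ∀ a b : X, ∃! c : X, a = op c b)
    (hQ3 : ∀ a b c : X, op (op a b) c = op (op a c) (op b c)) :
    Nonempty (rackH op 2 ≃+
      quandleH op 2 × quandleH op 1 × FreeAbelianGroup (Orb op × Orb op)) :=
  S14.main op hQ1
end
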